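/- If M is a finitely generated Σ-dual Rickart R-module, then its endomorphism ring S = End_R(M) is a hereditary ring, i.e., every ideal of S is projective as an S-module. -/

import Mathlib

universe u v

/-- A module `M` is dual-Rickart if the image of every endomorphism is a direct summand. -/
def IsDualRickart (R : Type u) [Ring R] (M : Type v) [AddCommGroup M] [Module R M] : Prop :=
  ∀ φ : M →ₗ[R] M, ∃ q : Submodule R M, IsCompl (LinearMap.range φ) q

/-- A module `M` is Σ-dual Rickart if every direct sum of copies of `M` is dual-Rickart. -/
def IsSigmaDualRickart (R : Type u) [Ring R] (M : Type v) [AddCommGroup M] [Module R M] :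
    Prop :=
  ∀ Λ : Type v, IsDualRickart R (Λ →₀ M)


section LemmaA

theorem exists_indep_mod {K E : Type v} [Ring K] [Nontrivial K] [AddCommGroup E] [Module K E]
    (hK : ∀ a : K, IsUnit a ∨ a = 0) (V W : Submodule K E) :
    ∃ (κ : Type v) (a : κ → E), (∀ k, a k ∈ V) ∧ V ≤ Submodule.span K (Set.range a) ⊔ W ∧
      LinearIndependent K (fun k => W.mkQ (a k)) := by
  let _ := DivisionRing.ofIsUnitOrEqZero hK
  obtain ⟨κ, a, -, hs, hl⟩ := exists_linearIndependent' K (fun x : V => W.mkQ (x : E))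
  refine ⟨κ, fun k => (a k : E), fun k => (a k).2, ?_, hl⟩
  intro x hx
  have h1 : W.mkQ x ∈ Submodule.span K (Set.range (fun x : V => W.mkQ (x : E))) :=
    Submodule.subset_span ⟨⟨x, hx⟩, rfl⟩
  rw [← hs] at h1
  have h2 : Set.range ((fun x : V => W.mkQ (x : E)) ∘ a)
      = W.mkQ '' (Set.range fun k => (a k : E)) := by
    rw [← Set.range_comp]; rfl
  rw [h2, Submodule.span_image] at h1
  obtain ⟨y, hy, hxy⟩ := h1
  have h3 : x - y ∈ W := by
    rw [← Submodule.ker_mkQ W, LinearMap.mem_ker, map_sub, hxy, sub_self]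
  have : x = y + (x - y) := by abel
  rw [this]
  exact Submodule.add_mem_sup hy h3

variable {R : Type u} [Ring R] {M : Type v} [AddCommGroup M] [Module R M]

/-- Precomposition as a map of modules over the endomorphism ring. -/
def preC {X Y : Type v} [AddCommGroup X] [Module R X] [AddCommGroup Y] [Module R Y]
    (q : Y →ₗ[R] X) : (X →ₗ[R] M) →ₗ[Module.End R M] (Y →ₗ[R] M) where
  toFun h := h ∘ₗ q
  map_add' _ _ := rfl
  map_smul' _ _ := rfl

theorem lemmaA {T : Type} [PartialOrder T] [Finite T] (N : T → Type v)
    [∀ t, AddCommGroup (N t)] [∀ t, Module R (N t)] [∀ t, Nontrivial (N t)]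
    (ι : ∀ t, N t →ₗ[R] M) (π : ∀ t, M →ₗ[R] N t) (hπ : ∀ t, π t ∘ₗ ι t = LinearMap.id)
    (hdiv : ∀ t (f : Module.End R (N t)), IsUnit f ∨ f = 0)
    (hord : ∀ s t (f : N s →ₗ[R] N t), f ≠ 0 → s ≤ t)
    (hone : (1 : Module.End R M) ∈ AddSubmonoid.closure
      {f : Module.End R M | ∃ (t : T) (a : N t →ₗ[R] M) (b : M →ₗ[R] N t), f = a ∘ₗ b})
    (h4 : ∀ (F : Type v) [Fintype F] (τ : F → T) (q : M →ₗ[R] (∀ f, N (τ f))),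
      ∃ p : (∀ f, N (τ f)) →ₗ[R] (∀ f, N (τ f)), p ∘ₗ p = p ∧ p ∘ₗ q = 0 ∧
        (p = 0 → Function.Surjective q))
    (I : Ideal (Module.End R M)) : Module.Projective (Module.End R M) I := by
  classical
  let V : ∀ t, Submodule (Module.End R (N t)) (M →ₗ[R] N t) := fun t =>
    { carrier := {q | (ι t ∘ₗ q : Module.End R M) ∈ I}
      zero_mem' := by
        change (ι t ∘ₗ (0 : M →ₗ[R] N t) : Module.End R M) ∈ I
        rw [LinearMap.comp_zero]; exact I.zero_mem
      add_mem' := by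
        intro a b ha hb
        change (ι t ∘ₗ (a + b) : Module.End R M) ∈ I
        rw [LinearMap.comp_add]; exact I.add_mem ha hb
      smul_mem' := by
        intro d q hq
        have h := I.mul_mem_left (ι t ∘ₗ d ∘ₗ π t) hq
        change (ι t ∘ₗ (d • q) : Module.End R M) ∈ I
        convert h using 1
        ext x
        have := LinearMap.congr_fun (hπ t) (q x)
        simp at this
        simp [this] }
  have hV : ∀ t q, q ∈ V t ↔ (ι t ∘ₗ q : Module.End R M) ∈ I := fun t q => Iff.rfl
  have hVI : ∀ t q, q ∈ V t → ∀ {h : N t →ₗ[R] M}, (h ∘ₗ q : Module.End R M) ∈ I := by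
    intro t q hq h
    have h' := I.mul_mem_left (h ∘ₗ π t) hq
    convert h' using 1
    ext x
    have := LinearMap.congr_fun (hπ t) (q x)
    simp at this
    simp [this]
  let W : ∀ t, Submodule (Module.End R (N t)) (M →ₗ[R] N t) := fun t =>
    Submodule.span _ {w | ∃ s, s < t ∧ ∃ q ∈ V s, ∃ h : N s →ₗ[R] N t, w = h ∘ₗ q}
  choose κ a haV hVs hli using fun t => exists_indep_mod (hdiv t) (V t) (W t)
  let A : Type v := Σ t, κ t
  let q : ∀ α : A, M →ₗ[R] N α.1 := fun α => a α.1 α.2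
  have hqV : ∀ α, q α ∈ V α.1 := fun α => haV _ _
  let Φ : (DirectSum A fun α => (N α.1 →ₗ[R] M)) →ₗ[Module.End R M] Module.End R M :=
    DirectSum.toModule _ _ _ (fun α => preC (q α))
  have hΦ1 : ∀ α (h : N α.1 →ₗ[R] M), Φ (DirectSum.lof (Module.End R M) A _ α h) = h ∘ₗ q α := by
    intro α h
    simp only [Φ, DirectSum.toModule_lof]; rfl
  -- range
  have hle : LinearMap.range Φ ≤ I := by
    rintro _ ⟨x, rfl⟩
    induction x using DirectSum.induction_on with
    | zero => simp
    | of α h => 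
      have := hΦ1 α h
      rw [DirectSum.lof_eq_of] at this
      rw [this]; exact hVI _ _ (hqV α)
    | add x y hx hy => rw [map_add]; exact I.add_mem hx hy
  have hgen : ∀ t, ∀ w ∈ V t, ∀ h : N t →ₗ[R] M,
      (h ∘ₗ w : Module.End R M) ∈ LinearMap.range Φ := by
    intro t
    induction t using (wellFounded_lt (α := T)).induction with
    | _ t ih =>
    let U : Submodule (Module.End R (N t)) (M →ₗ[R] N t) :=
      { carrier := {w | ∀ h : N t →ₗ[R] M, (h ∘ₗ w : Module.End R M) ∈ LinearMap.range Φ}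
        zero_mem' := by
          intro h
          rw [LinearMap.comp_zero]; exact Submodule.zero_mem _
        add_mem' := by
          intro a b ha hb h
          rw [LinearMap.comp_add]; exact Submodule.add_mem _ (ha h) (hb h)
        smul_mem' := by
          intro d w hw h
          exact hw (h ∘ₗ d) }
    have hU : V t ≤ U := by
      refine (hVs t).trans (sup_le ?_ ?_)
      · rw [Submodule.span_le]
        rintro _ ⟨k, rfl⟩ h
        exact ⟨_, hΦ1 ⟨t, k⟩ h⟩
      · rw [Submodule.span_le]
        rintro _ ⟨s, hs, w, hw, g, rfl⟩ h
        exact ih s hs w hw (h ∘ₗ g)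
    exact fun w hw h => hU hw h
  have hge : I ≤ LinearMap.range Φ := by
    intro f hf
    have key : ∀ g ∈ AddSubmonoid.closure
      {f : Module.End R M | ∃ (t : T) (a : N t →ₗ[R] M) (b : M →ₗ[R] N t), f = a ∘ₗ b},
        g * f ∈ LinearMap.range Φ := by
      intro g hg
      induction hg using AddSubmonoid.closure_induction with
      | mem x hx =>
        obtain ⟨t, a, b, rfl⟩ := hx
        refine hgen t (b ∘ₗ f) ?_ a
        exact I.mul_mem_left (ι t ∘ₗ b) hf
      | zero => rw [zero_mul]; exact Submodule.zero_mem _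
      | add x y _ _ hx hy => rw [add_mul]; exact Submodule.add_mem _ hx hy
    simpa using key 1 hone
  -- independence
  have hind : ∀ (t : T) (F : Finset A) (h : ∀ γ : A, N γ.1 →ₗ[R] N t),
      ∑ γ ∈ F, h γ ∘ₗ q γ = 0 → ∀ k : κ t, (⟨t, k⟩ : A) ∈ F → h ⟨t, k⟩ = 0 := by
    intro t F h hsum k hk
    have hinj : Set.InjOn (fun k : κ t => (⟨t, k⟩ : A)) ((fun k : κ t => (⟨t, k⟩ : A)) ⁻¹' ↑F) :=
      fun x _ y _ hxy => by simpa using hxy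
    refine (linearIndependent_iff'.1 (hli t)) (F.preimage (fun k => (⟨t, k⟩ : A)) hinj)
      (fun k => h ⟨t, k⟩) ?_ k (by simpa using hk)
    have e1 : ∑ i ∈ F.preimage (fun k => (⟨t, k⟩ : A)) hinj, (h ⟨t, i⟩ : Module.End R (N t)) • a t i
        = ∑ γ ∈ F with γ ∈ Set.range (fun k : κ t => (⟨t, k⟩ : A)), h γ ∘ₗ q γ :=
      Finset.sum_preimage' (fun k : κ t => (⟨t, k⟩ : A)) F hinj (fun γ => h γ ∘ₗ q γ)
    have e2 : ∑ γ ∈ F with ¬ γ ∈ Set.range (fun k : κ t => (⟨t, k⟩ : A)), h γ ∘ₗ q γ ∈ W t := by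
      refine Submodule.sum_mem _ fun γ hγ => ?_
      by_cases h0 : h γ = 0
      · rw [h0, LinearMap.zero_comp]; exact Submodule.zero_mem _
      · refine Submodule.subset_span ⟨γ.1, lt_of_le_of_ne (hord _ _ _ h0) ?_, q γ, hqV γ, h γ, rfl⟩
        rintro hh
        obtain ⟨s, k⟩ := γ
        subst hh
        simp at hγ
    rw [← Finset.sum_filter_add_sum_filter_not F
      (fun γ => γ ∈ Set.range (fun k : κ t => (⟨t, k⟩ : A))), ← e1] at hsum
    have e3 : ∑ i ∈ F.preimage (fun k => (⟨t, k⟩ : A)) hinj,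
        (h ⟨t, i⟩ : Module.End R (N t)) • a t i ∈ W t := by
      rw [eq_neg_of_add_eq_zero_left hsum]; exact Submodule.neg_mem _ e2
    rw [← Submodule.ker_mkQ (W t), LinearMap.mem_ker, map_sum] at e3
    simpa using e3
  have hsurj : ∀ F : Finset A, Function.Surjective
      (LinearMap.pi (fun α : F => q α) : M →ₗ[R] (∀ α : F, N (α : A).1)) := by
    intro F
    obtain ⟨p, hpp, hpq, hp0⟩ := h4 F (fun α => (α : A).1) (LinearMap.pi (fun α : F => q α))
    apply hp0
    let P : ∀ β γ : F, N (γ : A).1 →ₗ[R] N (β : A).1 := fun β γ =>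
      LinearMap.proj β ∘ₗ p ∘ₗ LinearMap.single R (fun α : F => N (α : A).1) γ
    have hP : ∀ β (x : ∀ α : F, N (α : A).1), p x β = ∑ γ, P β γ (x γ) := by
      intro β x
      conv_lhs => rw [← LinearMap.sum_single_apply (fun α : F => N (α : A).1) x, map_sum]
      simp [P]
    have hP0 : ∀ β γ : F, (β : A).1 = (γ : A).1 → P β γ = 0 := by
      rintro ⟨⟨t, k⟩, hβ⟩ ⟨⟨t', k'⟩, hγ⟩ hh
      simp only at hh
      subst hh
      have := hind t F (fun γ => if hγ : γ ∈ F then P ⟨⟨t, k⟩, hβ⟩ ⟨γ, hγ⟩ else 0) ?_ k' hγ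
      · simpa [hγ] using this
      · rw [← Finset.sum_coe_sort]
        ext x
        have h1 := hP ⟨⟨t, k⟩, hβ⟩ (LinearMap.pi (fun α : F => q α) x)
        have h2 := LinearMap.congr_fun hpq x
        simp only [LinearMap.comp_apply, LinearMap.zero_apply] at h2
        rw [h2] at h1
        simp only [LinearMap.pi_apply, Pi.zero_apply] at h1
        simp only [LinearMap.sum_apply, LinearMap.zero_apply]
        rw [h1]
        refine Finset.sum_congr rfl fun γ _ => ?_
        simp
    have hz : ∀ t, ∀ β : F, (β : A).1 = t → ∀ x, p x β = 0 := by
      intro t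
      induction t using (wellFounded_lt (α := T)).induction with
      | _ t ih =>
      rintro β rfl x
      rw [← hpp, LinearMap.comp_apply, hP]
      refine Finset.sum_eq_zero fun γ _ => ?_
      by_cases h0 : P β γ = 0
      · simp [h0]
      · rw [ih (γ : A).1 (lt_of_le_of_ne (hord _ _ _ h0) fun hh => h0 (hP0 _ _ hh.symm)) γ rfl,
          map_zero]
    ext1 
    ext x β
    simp [hz _ β rfl]
  have hinj : Function.Injective Φ := by
    rw [injective_iff_map_eq_zero]
    intro x hx
    let F := DFinsupp.support x
    have hsum : Φ x = ∑ α ∈ F, (x α) ∘ₗ q α := by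
      conv_lhs => rw [← DirectSum.sum_support_of x, map_sum]
      refine Finset.sum_congr rfl fun α _ => ?_
      rw [← hΦ1, DirectSum.lof_eq_of]
    have hz : ∀ y : (∀ α : F, N (α : A).1), ∑ α : F, x α (y α) = 0 := by
      intro y
      obtain ⟨m, rfl⟩ := hsurj F y
      rw [hx] at hsum
      have := LinearMap.congr_fun hsum m
      rw [← Finset.sum_coe_sort] at this
      simpa [LinearMap.sum_apply] using this.symm
    by_contra hne
    obtain ⟨α, hα⟩ : ∃ α, x α ≠ 0 := by
      by_contra hh; push Not at hh; exact hne (DFinsupp.ext hh)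
    have hαF : α ∈ F := DFinsupp.mem_support_iff.2 hα
    apply hα
    ext z
    have := hz (Pi.single ⟨α, hαF⟩ z)
    rw [Finset.sum_eq_single ⟨α, hαF⟩] at this
    · simpa using this
    · intro b _ hb
      rw [Pi.single_eq_of_ne hb, map_zero]
    · simp
  have hproj : ∀ t, Module.Projective (Module.End R M) (N t →ₗ[R] M) := fun t =>
    Module.Projective.of_split (M := Module.End R M) (preC (π t)) (preC (ι t)) (by
      ext h x
      have := LinearMap.congr_fun (hπ t) x
      simp at this
      simp [preC, this])
  have hr : LinearMap.range Φ = I := le_antisymm hle hge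
  exact Module.Projective.of_equiv
    ((LinearEquiv.ofInjective Φ hinj).trans (LinearEquiv.ofEq _ _ hr))

end LemmaA

section PartB
variable {R : Type u} [Ring R] {M : Type v} [AddCommGroup M] [Module R M]

/-- `X` is a retract of a direct sum of copies of `M`. -/
def Retr (R : Type u) [Ring R] (M : Type v) [AddCommGroup M] [Module R M]
    (X : Type v) [AddCommGroup X] [Module R X] : Prop :=
  ∃ (L : Type v) (i : X →ₗ[R] (L →₀ M)) (p : (L →₀ M) →ₗ[R] X), p ∘ₗ i = LinearMap.id

theorem Retr.of {X Y : Type v} [AddCommGroup X] [Module R X] [AddCommGroup Y] [Module R Y]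
    (hY : Retr R M Y) (i : X →ₗ[R] Y) (p : Y →ₗ[R] X) (h : p ∘ₗ i = LinearMap.id) :
    Retr R M X := by
  obtain ⟨L, j, r, hr⟩ := hY
  refine ⟨L, j ∘ₗ i, p ∘ₗ r, ?_⟩
  ext x
  have h1 := LinearMap.congr_fun hr (i x)
  have h2 := LinearMap.congr_fun h x
  simp at h1 h2
  simp [h1, h2]

theorem Retr.finsupp {L : Type} : Retr R M (L →₀ M) :=
  ⟨ULift.{v} L, (Finsupp.domLCongr Equiv.ulift.symm).toLinearMap,
    (Finsupp.domLCongr Equiv.ulift.symm).symm.toLinearMap, by ext; simp⟩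

theorem Retr.finsupp' {L : Type v} : Retr R M (L →₀ M) := ⟨L, .id, .id, rfl⟩

theorem Retr.self : Retr R M M :=
  Retr.finsupp (L := Unit).of (Finsupp.lsingle ()) (Finsupp.lapply ()) (by ext; simp)

theorem Retr.pi {F : Type v} [Fintype F] (N : F → Type v) [∀ t, AddCommGroup (N t)]
    [∀ t, Module R (N t)] (ι : ∀ t, N t →ₗ[R] M) (π : ∀ t, M →ₗ[R] N t)
    (hπ : ∀ t, π t ∘ₗ ι t = LinearMap.id) : Retr R M (∀ t, N t) := by
  have h1 : Retr R M (F → M) := (Retr.finsupp' (L := F)).of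
    (Finsupp.linearEquivFunOnFinite R M F).symm.toLinearMap
    (Finsupp.linearEquivFunOnFinite R M F).toLinearMap (by ext; simp)
  refine h1.of (LinearMap.pi fun t => ι t ∘ₗ LinearMap.proj t)
    (LinearMap.pi fun t => π t ∘ₗ LinearMap.proj t) ?_
  refine LinearMap.ext fun x => funext fun t => ?_
  exact LinearMap.congr_fun (hπ t) (x t)

theorem Retr.summand (hM : IsSigmaDualRickart R M) {X Y : Type v} [AddCommGroup X] [Module R X]
    [AddCommGroup Y] [Module R Y] (hX : Retr R M X) (hY : Retr R M Y) (φ : Y →ₗ[R] X) :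
    ∃ C : Submodule R X, IsCompl (LinearMap.range φ) C := by
  obtain ⟨L, i, p, hip⟩ := hX
  obtain ⟨L', j, r, hjr⟩ := hY
  let e := Finsupp.sumFinsuppLEquivProdFinsupp R (M := M) (α := L) (β := L')
  let i' : X →ₗ[R] (L ⊕ L' →₀ M) := e.symm.toLinearMap ∘ₗ LinearMap.inl R _ _ ∘ₗ i
  let r' : (L ⊕ L' →₀ M) →ₗ[R] Y := r ∘ₗ LinearMap.snd R _ _ ∘ₗ e.toLinearMap
  have hi' : Function.Injective i' := by
    have : (p ∘ₗ LinearMap.fst R _ _ ∘ₗ e.toLinearMap) ∘ₗ i' = LinearMap.id := by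
      ext x
      have := LinearMap.congr_fun hip x
      simp at this
      simp [i', this]
    exact Function.LeftInverse.injective (g := (p ∘ₗ LinearMap.fst R _ _ ∘ₗ e.toLinearMap))
      (LinearMap.congr_fun this)
  have hr' : Function.Surjective r' := by
    intro y
    refine ⟨e.symm (0, j y), ?_⟩
    have := LinearMap.congr_fun hjr y
    simp at this
    simp [r', this]
  obtain ⟨C, hC⟩ := hM (L ⊕ L') (i' ∘ₗ φ ∘ₗ r')
  have hmem : ∀ y, i' (φ y) ∈ LinearMap.range (i' ∘ₗ φ ∘ₗ r') := by
    intro y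
    obtain ⟨z, rfl⟩ := hr' y
    exact ⟨z, rfl⟩
  refine ⟨C.comap i', ?_, ?_⟩
  · rw [Submodule.disjoint_def]
    rintro _ ⟨y, rfl⟩ hx
    have := (Submodule.disjoint_def.1 hC.disjoint) _ (hmem y) hx
    exact hi' (by simpa using this)
  · rw [codisjoint_iff, eq_top_iff]
    intro x _
    have hx : i' x ∈ LinearMap.range (i' ∘ₗ φ ∘ₗ r') ⊔ C := by
      rw [hC.sup_eq_top]; trivial
    obtain ⟨_, ⟨z, rfl⟩, c, hc, hzc⟩ := Submodule.mem_sup.1 hx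
    refine Submodule.mem_sup.2 ⟨φ (r' z), ⟨_, rfl⟩, x - φ (r' z), ?_, by abel⟩
    rw [Submodule.mem_comap, map_sub, ← hzc]
    simpa using hc

theorem end_summand (hM : IsSigmaDualRickart R M) (f : Module.End R M) :
    ∃ p : Module.End R M, p * p = p ∧ LinearMap.range p = LinearMap.range f := by
  obtain ⟨C, hC⟩ := Retr.summand hM Retr.self Retr.self f
  exact ⟨Submodule.projection _ _ hC, Submodule.isIdempotentElem_projection hC,
    Submodule.range_projection hC⟩

/-- Submodules that are images of endomorphisms. -/
def Imgs (R : Type u) [Ring R] (M : Type v) [AddCommGroup M] [Module R M] : Type v :=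
  {N : Submodule R M // ∃ f : Module.End R M, LinearMap.range f = N}

instance : PartialOrder (Imgs R M) := inferInstanceAs (PartialOrder (Subtype _))

theorem wf_imgs [Module.Finite R M] (hM : IsSigmaDualRickart R M) : WellFoundedGT (Imgs R M) := by
  classical
  rw [wellFoundedGT_iff_monotone_chain_condition]
  intro c
  have hmono : Monotone fun n => (c n).1 := fun a b h => c.monotone h
  choose f hf using fun n => (c n).2
  obtain ⟨C, hC⟩ := Retr.summand hM Retr.self (Retr.finsupp (L := ℕ)) (Finsupp.lsum ℕ f)
  set U := LinearMap.range (Finsupp.lsum ℕ f) with hU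
  have hle : ∀ n, (c n).1 ≤ U := by
    intro n
    rw [← hf n]
    rintro _ ⟨x, rfl⟩
    exact ⟨Finsupp.single n x, by simp⟩
  have hge : U ≤ ⨆ n, (c n).1 := by
    rintro _ ⟨x, rfl⟩
    rw [Finsupp.lsum_apply]
    refine Submodule.sum_mem _ fun n _ => ?_
    refine Submodule.mem_iSup_of_mem n ?_
    rw [← hf n]; exact ⟨_, rfl⟩
  have hfg : U.FG := by
    rw [← Submodule.range_projection hC, ← Submodule.map_top]
    exact Module.Finite.fg_top.map _
  obtain ⟨s, hs⟩ := hfg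
  have hin : ∀ s : Finset M, (∀ x ∈ s, x ∈ U) → ∃ n, ∀ x ∈ s, x ∈ (c n).1 := by
    intro s
    induction s using Finset.induction_on with
    | empty => intro _; exact ⟨0, by simp⟩
    | insert a s _ ih =>
      intro h
      obtain ⟨n, hn⟩ := ih fun x hx => h x (Finset.mem_insert_of_mem hx)
      obtain ⟨m, hm⟩ := (Submodule.mem_iSup_of_directed _ hmono.directed_le).1
        (hge (h a (Finset.mem_insert_self _ _)))
      refine ⟨max n m, fun x hx => ?_⟩
      rcases Finset.mem_insert.1 hx with rfl | hx
      · exact hmono (le_max_right _ _) hm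
      · exact hmono (le_max_left _ _) (hn x hx)
  obtain ⟨n, hn⟩ := hin s fun x hx => hs ▸ Submodule.subset_span hx
  have hUn : U ≤ (c n).1 := by
    rw [← hs, Submodule.span_le]; exact hn
  exact ⟨n, fun m hm => le_antisymm (c.monotone hm) ((hle m).trans hUn)⟩

theorem exists_pow [Module.Finite R M] (hM : IsSigmaDualRickart R M) (f : Module.End R M) :
    ∃ (k : ℕ) (g : Module.End R M), f ^ k = g * f ^ (k + 1) := by
  let φ : (ℕ →₀ M) →ₗ[R] (ℕ →₀ M) :=
    Finsupp.lsum ℕ fun n => Finsupp.lsingle n - Finsupp.lsingle (n + 1) ∘ₗ f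
  have hφ1 : ∀ n x, φ (Finsupp.single n x) = Finsupp.single n x - Finsupp.single (n + 1) (f x) := by
    intro n x; simp [φ]
  have hφ0 : ∀ x, φ x 0 = x 0 := by
    intro x
    induction x using Finsupp.induction_linear with
    | zero => simp
    | add a b ha hb => simp [ha, hb]
    | single n m => rw [hφ1]; simp
  have hφs : ∀ x n, φ x (n + 1) = x (n + 1) - f (x n) := by
    intro x k
    induction x using Finsupp.induction_linear with
    | zero => simp
    | add a b ha hb => simp [ha, hb]; abel
    | single n m =>
      rw [hφ1]
      by_cases h : n = k
      · subst h; simp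
      · simp [Finsupp.single_apply, h]
  have hinj : Function.Injective φ := by
    rw [injective_iff_map_eq_zero]
    intro x hx
    ext n
    induction n with
    | zero => rw [← hφ0, hx]
    | succ n ih =>
      have := hφs x n
      rw [hx, ih] at this
      simpa using this.symm
  obtain ⟨C, hC⟩ := Retr.summand hM (Retr.finsupp (L := ℕ)) (Retr.finsupp (L := ℕ)) φ
  let ψ : (ℕ →₀ M) →ₗ[R] (ℕ →₀ M) :=
    (LinearEquiv.ofInjective φ hinj).symm.toLinearMap ∘ₗ Submodule.projectionOnto _ _ hC
  have hψ : ∀ x, ψ (φ x) = x := by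
    intro x
    have : Submodule.projectionOnto _ _ hC (φ x) = LinearEquiv.ofInjective φ hinj x := by
      rw [Submodule.projectionOnto_apply_of_mem_left hC ⟨x, rfl⟩]; rfl
    simp [ψ, this]
  have hrec : ∀ n x, ψ (Finsupp.single n x) =
      Finsupp.single n x + ψ (Finsupp.single (n + 1) (f x)) := by
    intro n x
    have := hψ (Finsupp.single n x)
    rw [hφ1, map_sub] at this
    exact sub_eq_iff_eq_add.1 this
  -- coordinates
  have hco : ∀ k x n, n ≤ k → ψ (Finsupp.single 0 x) k =
      (if n = k + 1 then (f ^ k) x else 0) + ψ (Finsupp.single n ((f ^ n) x)) k := by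
    intro k x n
    induction n with
    | zero => intro _; simp
    | succ n ih =>
      intro hn
      rw [ih (by omega), hrec n]
      have h1 : n ≠ k := by omega
      have h2 : n ≠ k + 1 := by omega
      simp [h1, h2, Finsupp.single_apply, pow_succ' f n]
  have hco2 : ∀ k x, ψ (Finsupp.single 0 x) k =
      (f ^ k) x + ψ (Finsupp.single (k + 1) ((f ^ (k + 1)) x)) k := by
    intro k x
    rw [hco k x k le_rfl, hrec k]
    simp [pow_succ' f k]
  have hfin : ∃ k, ∀ x, ψ (Finsupp.single 0 x) k = 0 := by
    obtain ⟨s, hs⟩ := (Module.Finite.fg_top : (⊤ : Submodule R M).FG)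
    classical
    let F : Finset ℕ := s.biUnion fun x => (ψ (Finsupp.single 0 x)).support
    obtain ⟨k, hk⟩ := Infinite.exists_notMem_finset F
    refine ⟨k, fun x => ?_⟩
    have hx : x ∈ Submodule.span R (s : Set M) := by rw [hs]; trivial
    have hle : Submodule.span R (s : Set M) ≤
        LinearMap.ker (Finsupp.lapply k ∘ₗ ψ ∘ₗ Finsupp.lsingle 0) := by
      rw [Submodule.span_le]
      intro y hy
      by_contra hne
      apply hk
      refine Finset.mem_biUnion.2 ⟨y, hy, ?_⟩
      rw [Finsupp.mem_support_iff]
      exact hne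
    exact hle hx
  obtain ⟨k, hk⟩ := hfin
  refine ⟨k, -(Finsupp.lapply k ∘ₗ ψ ∘ₗ Finsupp.lsingle (k + 1)), ?_⟩
  ext x
  have := hco2 k x
  rw [hk x] at this
  have := eq_neg_of_add_eq_zero_left this.symm
  rw [this]
  rfl

/-- Primitive idempotents. -/
def Prim {S : Type*} [Ring S] (d : S) : Prop :=
  d * d = d ∧ d ≠ 0 ∧ ∀ x, x * x = x → d * x = x → x * d = x → x = 0 ∨ x = d

theorem prim_range (hM : IsSigmaDualRickart R M) {d : Module.End R M} (hd : Prim d)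
    {f : Module.End R M} (hdf : d * f = f) (hf : f ≠ 0) :
    LinearMap.range f = LinearMap.range d := by
  obtain ⟨p, hpp, hpr⟩ := end_summand hM f
  have hfix : ∀ y ∈ LinearMap.range p, p y = y := by
    rintro _ ⟨x, rfl⟩
    exact LinearMap.congr_fun hpp x
  have hpf : p * f = f := by
    ext x
    exact hfix _ (hpr ▸ ⟨x, rfl⟩)
  have hdp : d * p = p := by
    ext x
    have : p x ∈ LinearMap.range f := hpr ▸ ⟨x, rfl⟩
    obtain ⟨y, hy⟩ := this
    change d (p x) = p x
    rw [← hy]; exact LinearMap.congr_fun hdf y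
  have hx := hd.2.2 (p * d) (by rw [mul_assoc, ← mul_assoc d p d, hdp, ← mul_assoc, hpp])
    (by rw [← mul_assoc, hdp]) (by rw [mul_assoc, hd.1])
  rcases hx with hx | hx
  · exfalso; apply hf
    rw [← hpf, ← hdf, ← mul_assoc, hx, zero_mul]
  · apply le_antisymm
    · rw [← hdf]; exact LinearMap.range_comp_le_range _ _
    · rw [← hpr, ← hx]; exact LinearMap.range_comp_le_range _ _

theorem prim_inj [Module.Finite R M] (hM : IsSigmaDualRickart R M) {d : Module.End R M}
    (hd : Prim d) {f : Module.End R M} (hdf : d * f = f) (hfd : f * d = f) (hf : f ≠ 0)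
    {x : M} (hx : x ∈ LinearMap.range d) (hfx : f x = 0) : x = 0 := by
  obtain ⟨k, g, hg⟩ := exists_pow hM f
  have hr := prim_range hM hd hdf hf
  have hpow : ∀ k, ∀ x ∈ LinearMap.range d, ∃ y, (f ^ k) y = x := by
    intro k
    induction k with
    | zero => intro x _; exact ⟨x, rfl⟩
    | succ k ih =>
      intro x hx
      rw [← hr] at hx
      obtain ⟨y, rfl⟩ := hx
      obtain ⟨z, hz⟩ := ih (d y) ⟨y, rfl⟩
      refine ⟨z, ?_⟩
      rw [pow_succ']
      change f ((f ^ k) z) = _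
      rw [hz]; exact LinearMap.congr_fun hfd y
  obtain ⟨y, rfl⟩ := hpow k x hx
  rw [pow_succ'] at hg
  have := LinearMap.congr_fun hg y
  rw [this]
  change g (f ((f ^ k) y)) = 0
  rw [hfx, map_zero]

theorem range_lt {c x : Module.End R M} (hc : c * c = c) (hx : x * x = x) (hcx : c * x = 0)
    (hxc : x * c = 0) (h0 : x ≠ 0) : LinearMap.range c < LinearMap.range (c + x) := by
  apply lt_of_le_of_ne
  · have : c = (c + x) * c := by rw [add_mul, hc, hxc, add_zero]
    conv_lhs => rw [this]
    exact LinearMap.range_comp_le_range _ _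
  · intro h
    apply h0
    ext m
    have h1 : x m ∈ LinearMap.range c := by
      rw [h]
      refine ⟨x m, ?_⟩
      change c (x m) + x (x m) = x m
      have h2 : c (x m) = 0 := LinearMap.congr_fun hcx m
      have h3 : x (x m) = x m := LinearMap.congr_fun hx m
      rw [h2, h3, zero_add]
    obtain ⟨y, hy⟩ := h1
    have h2 : c (x m) = 0 := LinearMap.congr_fun hcx m
    have h3 : c (c y) = c y := LinearMap.congr_fun hc y
    rw [← hy, h3, hy] at h2
    exact h2

theorem exists_max [Module.Finite R M] (hM : IsSigmaDualRickart R M)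
    (A : Set (Module.End R M)) (hA : A.Nonempty) :
    ∃ c ∈ A, ∀ c' ∈ A, ¬ LinearMap.range c < LinearMap.range c' := by
  have := wf_imgs hM
  let r : Module.End R M → Imgs R M := fun c => ⟨LinearMap.range c, c, rfl⟩
  obtain ⟨c, hc, h⟩ := (InvImage.wf r (wellFounded_gt (α := Imgs R M))).has_min A hA
  exact ⟨c, hc, fun c' hc' hlt => h c' hc' hlt⟩

theorem exists_prim [Module.Finite R M] (hM : IsSigmaDualRickart R M) {e : Module.End R M}
    (he : e * e = e) (he0 : e ≠ 0) : ∃ d, Prim d ∧ e * d = d ∧ d * e = d := by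
  obtain ⟨c, ⟨hcc, hec, hce, hne⟩, hmax⟩ := exists_max hM
    {c | c * c = c ∧ e * c = c ∧ c * e = c ∧ c ≠ e} ⟨0, by simp [he0.symm]⟩
  refine ⟨e - c, ⟨?_, sub_ne_zero.2 hne.symm, ?_⟩, ?_, ?_⟩
  · simp only [sub_mul, mul_sub, he, hcc, hec, hce]; abel
  · intro x hxx hdx hxd
    by_contra hh
    push Not at hh
    have hex : e * x = x := by
      rw [← hdx, ← mul_assoc, mul_sub, he, hec]
    have hxe : x * e = x := by
      rw [← hxd, mul_assoc, sub_mul, he, hce]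
    have hcx : c * x = 0 := by
      rw [sub_mul, hex] at hdx; simpa using hdx
    have hxc : x * c = 0 := by
      rw [mul_sub, hxe] at hxd; simpa using hxd
    refine hmax (c + x) ⟨?_, ?_, ?_, ?_⟩ (range_lt hcc hxx hcx hxc hh.1)
    · simp [mul_add, add_mul, hcc, hxx, hcx, hxc]
    · rw [mul_add, hec, hex]
    · rw [add_mul, hce, hxe]
    · intro h; apply hh.2; rw [← h]; abel
  · rw [mul_sub, he, hec]
  · rw [sub_mul, he, hce]

theorem one_mem [Module.Finite R M] (hM : IsSigmaDualRickart R M) :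
    (1 : Module.End R M) ∈ AddSubmonoid.closure {d : Module.End R M | Prim d} := by
  obtain ⟨c, ⟨hcc, hcm⟩, hmax⟩ := exists_max hM
    {c | c * c = c ∧ c ∈ AddSubmonoid.closure {d : Module.End R M | Prim d}}
    ⟨0, by simp, AddSubmonoid.zero_mem _⟩
  by_cases h1 : c = 1
  · rwa [← h1]
  exfalso
  obtain ⟨d, hd, h2, h3⟩ := exists_prim hM (e := 1 - c)
    (by simp only [sub_mul, mul_sub, hcc, one_mul, mul_one]; abel) (sub_ne_zero.2 (Ne.symm h1))
  have hcd : c * d = 0 := by rw [sub_mul, one_mul] at h2; simpa using h2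
  have hdc : d * c = 0 := by rw [mul_sub, mul_one] at h3; simpa using h3
  refine hmax (c + d) ⟨?_, ?_⟩ (range_lt hcc hd.1 hcd hdc hd.2.1)
  · simp [mul_add, add_mul, hcc, hd.1, hcd, hdc]
  · exact add_mem hcm (AddSubmonoid.subset_closure hd)

end PartB

/-- The endomorphism ring of a finitely generated Σ-dual Rickart module is hereditary:
every ideal is projective. -/
theorem stmt18 (R : Type u) [Ring R] (M : Type v) [AddCommGroup M] [Module R M]
    [Module.Finite R M] (hM : IsSigmaDualRickart R M) :
    ∀ I : Ideal (Module.End R M), Module.Projective (Module.End R M) I := by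
  obtain ⟨l, hl, hl1⟩ := AddSubmonoid.exists_list_of_mem_closure (one_mem hM)
  let d : Fin l.length → Module.End R M := fun i => l.get i
  have hd : ∀ i, Prim (d i) := fun i => hl _ (List.get_mem l i)
  let N' : Fin l.length → Submodule R M := fun i => LinearMap.range (d i)
  have hfix : ∀ i, ∀ x ∈ N' i, d i x = x := by
    rintro i _ ⟨x, rfl⟩
    exact LinearMap.congr_fun (hd i).1 x
  let ι' : ∀ i, N' i →ₗ[R] M := fun i => (N' i).subtype
  let π' : ∀ i, M →ₗ[R] N' i := fun i => (d i).rangeRestrict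
  have hπ' : ∀ i, π' i ∘ₗ ι' i = LinearMap.id := by
    intro i
    ext x
    exact hfix i x x.2
  have hιπ : ∀ i, ι' i ∘ₗ π' i = d i := fun i => rfl
  have hnt : ∀ i, Nontrivial (N' i) := by
    intro i
    rw [Submodule.nontrivial_iff_ne_bot, Ne, LinearMap.range_eq_bot]
    exact (hd i).2.1
  -- extension of a map to an endomorphism
  have hext0 : ∀ i j (f : N' i →ₗ[R] N' j), f ≠ 0 →
      (ι' j ∘ₗ f ∘ₗ π' i : Module.End R M) ≠ 0 := by
    intro i j f hf h
    apply hf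
    ext x
    have h1 := LinearMap.congr_fun h (ι' i x)
    have h2 : π' i (ι' i x) = x := LinearMap.congr_fun (hπ' i) x
    simp only [LinearMap.comp_apply, h2] at h1
    exact h1
  have hextd : ∀ i j (f : N' i →ₗ[R] N' j),
      d j * (ι' j ∘ₗ f ∘ₗ π' i : Module.End R M) = ι' j ∘ₗ f ∘ₗ π' i := by
    intro i j f
    ext x
    exact hfix j _ (f (π' i x)).2
  have hsurj : ∀ i j (f : N' i →ₗ[R] N' j), f ≠ 0 → Function.Surjective f := by
    intro i j f hf y
    have h := prim_range hM (hd j) (hextd i j f) (hext0 i j f hf)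
    have hy : (y : M) ∈ LinearMap.range (d j) := y.2
    rw [← h] at hy
    obtain ⟨x, hx⟩ := hy
    exact ⟨π' i x, Subtype.ext hx⟩
  have hinj : ∀ i (f : N' i →ₗ[R] N' i), f ≠ 0 → Function.Injective f := by
    intro i f hf
    rw [injective_iff_map_eq_zero]
    intro x hx
    have hπd : ∀ y, π' i (d i y) = π' i y := fun y => Subtype.ext (hfix i _ ⟨y, rfl⟩)
    have := prim_inj hM (hd i) (hextd i i f) (by
      ext y
      change ((f (π' i (d i y)) : N' i) : M) = _
      rw [hπd]; rfl) (hext0 i i f hf) x.2 (by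
      have h2 : π' i (ι' i x) = x := LinearMap.congr_fun (hπ' i) x
      change ((f (π' i (ι' i x)) : N' i) : M) = 0
      rw [h2, hx]; rfl)
    exact Subtype.ext this
  have hcomp : ∀ i j k (f : N' i →ₗ[R] N' j) (g : N' j →ₗ[R] N' k), f ≠ 0 → g ≠ 0 →
      g ∘ₗ f ≠ 0 := by
    intro i j k f g hf hg h
    apply hg
    ext y
    obtain ⟨x, rfl⟩ := hsurj i j f hf y
    rw [← LinearMap.comp_apply, h]; simp
  let st : Setoid (Fin l.length) :=
    { r := fun i j => Nonempty (N' i ≃ₗ[R] N' j)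
      iseqv := ⟨fun i => ⟨LinearEquiv.refl R _⟩, fun ⟨e⟩ => ⟨e.symm⟩,
        fun ⟨e⟩ ⟨e'⟩ => ⟨e.trans e'⟩⟩ }
  let T : Type := Quotient st
  let o : T → Fin l.length := fun t => t.out
  let po : PartialOrder T :=
    { le := fun s t => ∃ f : N' (o s) →ₗ[R] N' (o t), f ≠ 0
      lt := fun s t => (∃ f : N' (o s) →ₗ[R] N' (o t), f ≠ 0) ∧
        ¬ ∃ f : N' (o t) →ₗ[R] N' (o s), f ≠ 0
      lt_iff_le_not_ge := fun _ _ => Iff.rfl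
      le_refl := fun t => ⟨LinearMap.id, by
        intro h
        obtain ⟨x, hx⟩ := @exists_ne _ (hnt (o t)) (0 : N' (o t))
        exact hx (LinearMap.congr_fun h x)⟩
      le_trans := fun r s t ⟨f, hf⟩ ⟨g, hg⟩ => ⟨g ∘ₗ f, hcomp _ _ _ f g hf hg⟩
      le_antisymm := fun s t ⟨f, hf⟩ ⟨g, hg⟩ => by
        have h1 := hinj _ _ (hcomp _ _ _ f g hf hg)
        have h2 : Function.Injective f := Function.Injective.of_comp (f := g) h1
        have h3 : st.r (o s) (o t) := ⟨LinearEquiv.ofBijective f ⟨h2, hsurj _ _ f hf⟩⟩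
        exact Quotient.out_equiv_out.1 h3 }
  have hT : Finite T := inferInstanceAs (Finite (Quotient st))
  have hnt' : ∀ t : T, Nontrivial (N' (o t)) := fun t => hnt _
  refine lemmaA (T := T) (fun t => N' (o t)) (fun t => ι' (o t)) (fun t => π' (o t))
    (fun t => hπ' _) ?_ (fun s t f hf => Exists.intro f hf) ?_ ?_
  · intro t f
    by_cases hf : f = 0
    · exact Or.inr hf
    · exact Or.inl ((Module.End.isUnit_iff f).2 ⟨hinj _ f hf, hsurj _ _ f hf⟩)
  · rw [← hl1]
    refine AddSubmonoid.list_sum_mem _ fun x hx => ?_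
    obtain ⟨i, rfl⟩ := List.get_of_mem hx
    apply AddSubmonoid.subset_closure
    obtain ⟨e⟩ : st.r (o (Quotient.mk st i)) i := Quotient.mk_out (s := st) i
    refine ⟨Quotient.mk st i, ι' i ∘ₗ e.toLinearMap, e.symm.toLinearMap ∘ₗ π' i, ?_⟩
    change d i = _
    ext x
    simp [← hιπ]
  · intro F _ τ q
    obtain ⟨C, hC⟩ := Retr.summand hM
      (Retr.pi (M := M) (fun f => N' (o (τ f))) (fun f => ι' (o (τ f))) (fun f => π' (o (τ f)))
        (fun f => hπ' _)) Retr.self q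
    refine ⟨Submodule.projection _ _ hC.symm, Submodule.isIdempotentElem_projection hC.symm,
      ?_, ?_⟩
    · ext1 x
      rw [LinearMap.comp_apply, LinearMap.zero_apply, Submodule.projection_apply_eq_zero_iff]
      exact ⟨x, rfl⟩
    · intro h y
      have : Submodule.projection _ _ hC.symm y = 0 := by rw [h]; rfl
      rw [Submodule.projection_apply_eq_zero_iff] at this
      exact this
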